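/- Let u : ℝ × ℝ → ℝ be a C² solution of the Born–Infeld equation satisfying the regularity/decay and smallness hypotheses, and let λ(t) = C t/(log t)². Then there exists a strictly increasing sequence of times tₙ → +∞ such that lim_{n→∞} ∫_ℝ sech²(x/λ(tₙ)) ( (∂ₜu)² + (∂ₓu)² )(tₙ, x) dx = 0. -/

import Mathlib

open MeasureTheory Real Filter

/-- Time derivative `∂ₜ u` of a scalar field `u : ℝ × ℝ → ℝ` (first variable is time). -/
noncomputable def ut (u : ℝ × ℝ → ℝ) (t x : ℝ) : ℝ := deriv (fun s => u (s, x)) t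

/-- Space derivative `∂ₓ u`. -/
noncomputable def ux (u : ℝ × ℝ → ℝ) (t x : ℝ) : ℝ := deriv (fun y => u (t, y)) x

/-- `∂ₜ² u`. -/
noncomputable def utt (u : ℝ × ℝ → ℝ) (t x : ℝ) : ℝ := deriv (fun s => ut u s x) t

/-- `∂ₓ² u`. -/
noncomputable def uxx (u : ℝ × ℝ → ℝ) (t x : ℝ) : ℝ := deriv (fun y => ux u t y) x

/-- Mixed derivative `∂²ₜₓ u`. -/
noncomputable def utx (u : ℝ × ℝ → ℝ) (t x : ℝ) : ℝ := deriv (fun s => ux u s x) t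

/-- The Born–Infeld equation in 1+1 dimensions:
`(1 - (∂ₜu)²) ∂ₓ²u + 2 ∂ₓu ∂ₜu ∂²ₜₓu - (1 + (∂ₓu)²) ∂ₜ²u = 0`. -/
def IsBISol (u : ℝ × ℝ → ℝ) : Prop :=
  ∀ t x : ℝ,
    (1 - (ut u t x) ^ 2) * uxx u t x
      + 2 * ux u t x * ut u t x * utx u t x
      - (1 + (ux u t x) ^ 2) * utt u t x = 0

/-- The scaling function `λ(t) = C t / (log t)²`. -/
noncomputable def lam (C t : ℝ) : ℝ := C * t / (Real.log t) ^ 2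

/-- Hyperbolic secant. -/
noncomputable def sech (x : ℝ) : ℝ := 1 / Real.cosh x

section Calculus

theorem sech_sq_eq_inv_cosh_sq (y : ℝ) : sech y ^ 2 = (Real.cosh y ^ 2)⁻¹ := by
  simp [sech]

theorem continuous_sech : Continuous sech :=
  continuous_const.div Real.continuous_cosh fun x => (Real.cosh_pos x).ne'

theorem hasDerivAt_sinh_div_cosh (y : ℝ) :
    HasDerivAt (fun x => Real.sinh x / Real.cosh x) (sech y ^ 2) y := by
  have h := (Real.hasDerivAt_sinh y).div (Real.hasDerivAt_cosh y) (Real.cosh_pos y).ne'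
  refine h.congr_deriv ?_
  have hc := (Real.cosh_pos y).ne'
  rw [sech_sq_eq_inv_cosh_sq]
  have := Real.cosh_sq y
  field_simp
  linarith

theorem abs_sinh_div_cosh_le_one (y : ℝ) : |Real.sinh y / Real.cosh y| ≤ 1 := by
  rw [abs_div, abs_of_pos (Real.cosh_pos y), div_le_one (Real.cosh_pos y)]
  apply abs_le_of_sq_le_sq _ (Real.cosh_pos y).le
  linarith [Real.cosh_sq y]

theorem sech_sq_mul_abs_le_one (y : ℝ) : sech y ^ 2 * |y| ≤ 1 := by
  have h1 : |y| ≤ Real.cosh y := by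
    have h := Real.self_le_sinh_iff.2 (abs_nonneg y)
    have h2 := Real.sinh_lt_cosh |y|
    rw [Real.cosh_abs] at h2
    linarith
  have h2 := Real.one_le_cosh y
  rw [sech_sq_eq_inv_cosh_sq, inv_mul_le_iff₀ (by positivity)]
  nlinarith

theorem exists_strictMono_tendsto_zero {F : ℝ → ℝ} (hF : ∀ t, 0 ≤ F t)
    (h : ∀ c, 0 < c → ∀ T, ∃ t, T ≤ t ∧ F t < c) :
    ∃ s : ℕ → ℝ, StrictMono s ∧ Tendsto s atTop atTop ∧
      Tendsto (fun n => F (s n)) atTop (nhds 0) := by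
  choose f hf using fun n : ℕ => h (1 / ((n : ℝ) + 1)) (by positivity)
  let s : ℕ → ℝ := Nat.rec (f 0 0) fun n t => f (n + 1) (t + 1)
  have hstep : ∀ n, s n + 1 ≤ s (n + 1) := fun n => (hf (n + 1) (s n + 1)).1
  have hge : ∀ n : ℕ, (n : ℝ) ≤ s n := by
    intro n
    induction n with
    | zero => rw [Nat.cast_zero]; exact (hf 0 0).1
    | succ n ih => push_cast; linarith [hstep n]
  have hlt : ∀ n : ℕ, F (s n) < 1 / ((n : ℝ) + 1) := by
    rintro (_ | n)
    · exact (hf 0 0).2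
    · exact (hf (n + 1) (s n + 1)).2
  exact ⟨s, strictMono_nat_of_lt_succ fun n => by linarith [hstep n],
    tendsto_atTop_mono hge tendsto_natCast_atTop_atTop,
    squeeze_zero (fun n => hF _) (fun n => (hlt n).le) tendsto_one_div_add_atTop_nhds_zero_nat⟩

theorem not_bddBelow_of_hasDerivAt_le_neg_div {V V' : ℝ → ℝ} {T k B : ℝ} (hT : 0 < T)
    (hk : 0 < k) (hV : ∀ t, T ≤ t → HasDerivAt V (V' t) t) (hV' : ∀ t, T ≤ t → V' t ≤ -(k / t))
    (hB : ∀ t, T ≤ t → B ≤ V t) : False := by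
  have hW : ∀ t, T ≤ t → HasDerivAt (fun r => V r + k * Real.log r) (V' t + k * t⁻¹) t :=
    fun t ht => (hV t ht).add ((Real.hasDerivAt_log (by linarith)).const_mul k)
  have hanti : AntitoneOn (fun r => V r + k * Real.log r) (Set.Ici T) := by
    refine antitoneOn_of_deriv_nonpos (convex_Ici T)
      (fun t ht => (hW t ht).continuousAt.continuousWithinAt)
      (fun t ht => (hW t (interior_subset ht)).differentiableAt.differentiableWithinAt)
      fun t ht => ?_
    have htT : T ≤ t := interior_subset ht
    rw [(hW t htT).deriv, ← div_eq_mul_inv]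
    linarith [hV' t htT]
  obtain ⟨t, ht, htT⟩ := ((Real.tendsto_log_atTop.eventually_gt_atTop
    ((V T + k * Real.log T - B) / k)).and (eventually_ge_atTop T)).exists
  have h1 : V t + k * Real.log t ≤ V T + k * Real.log T := hanti Set.self_mem_Ici htT htT
  rw [div_lt_iff₀ hk] at ht
  linarith [hB t htT]

theorem integrable_of_continuous_of_vanishing {g : ℝ → ℝ} (hg : Continuous g) {R : ℝ}
    (h : ∀ x, R ≤ |x| → g x = 0) : Integrable g := by
  refine hg.integrable_of_hasCompactSupport
    (HasCompactSupport.intro (isCompact_Icc (a := -R) (b := R)) fun x hx => h x ?_)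
  by_contra! hlt
  exact hx ⟨(abs_lt.1 hlt).1.le, (abs_lt.1 hlt).2.le⟩

theorem integral_eq_intervalIntegral_of_vanishing {g : ℝ → ℝ} {R : ℝ}
    (h : ∀ x, R ≤ |x| → g x = 0) : ∫ x, g x = ∫ x in -R..R, g x := by
  refine (intervalIntegral.integral_eq_integral_of_support_subset fun x hx => ?_).symm
  have hlt : |x| < R := by
    by_contra! hle
    exact hx (h x hle)
  exact ⟨(abs_lt.1 hlt).1, (abs_lt.1 hlt).2.le⟩

theorem hasDerivAt_intervalIntegral_of_continuousOn {F F' : ℝ → ℝ → ℝ} {a b c d t : ℝ}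
    (ht : t ∈ Set.Ioo a b) (hcd : c ≤ d)
    (hF : ∀ s ∈ Set.Icc a b, ContinuousOn (F s) (Set.Icc c d))
    (hF' : ContinuousOn (fun z : ℝ × ℝ => F' z.1 z.2) (Set.Icc a b ×ˢ Set.Icc c d))
    (hd : ∀ s ∈ Set.Icc a b, ∀ x ∈ Set.Icc c d, HasDerivAt (fun r => F r x) (F' s x) s) :
    HasDerivAt (fun s => ∫ x in c..d, F s x) (∫ x in c..d, F' t x) t := by
  obtain ⟨M, hM⟩ := (isCompact_Icc.prod isCompact_Icc).exists_bound_of_continuousOn hF'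
  have hnhds : Set.Icc a b ∈ nhds t := Icc_mem_nhds ht.1 ht.2
  have hsub : Set.uIoc c d ⊆ Set.Icc c d := by
    rw [Set.uIoc_of_le hcd]; exact Set.Ioc_subset_Icc_self
  have hF't : ContinuousOn (F' t) (Set.Icc c d) :=
    hF'.comp (f := fun x => (t, x)) (by fun_prop)
      fun x hx => ⟨Set.Ioo_subset_Icc_self ht, hx⟩
  refine (intervalIntegral.hasDerivAt_integral_of_dominated_loc_of_deriv_le
    (bound := fun _ => M) hnhds ?_ ?_ ?_ ?_ (by simp) ?_).2
  · filter_upwards [hnhds] with s hs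
    exact ((hF s hs).mono hsub).aestronglyMeasurable measurableSet_uIoc
  · exact (hF t (Set.Ioo_subset_Icc_self ht)).intervalIntegrable_of_Icc hcd
  · exact (hF't.mono hsub).aestronglyMeasurable measurableSet_uIoc
  · exact .of_forall fun x hx s hs => hM (s, x) ⟨hs, hsub hx⟩
  · exact .of_forall fun x hx s hs => hd s hs x (hsub hx)

theorem ContDiff.hasDerivAt_fst {f : ℝ × ℝ → ℝ} (hf : ContDiff ℝ 1 f) (t x : ℝ) :
    HasDerivAt (fun s => f (s, x)) (fderiv ℝ f (t, x) (1, 0)) t :=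
  ((hf.differentiable (by norm_num)) (t, x)).hasFDerivAt.comp_hasDerivAt t
    ((hasDerivAt_id t).prodMk (hasDerivAt_const t x))

theorem ContDiff.hasDerivAt_snd {f : ℝ × ℝ → ℝ} (hf : ContDiff ℝ 1 f) (t x : ℝ) :
    HasDerivAt (fun y => f (t, y)) (fderiv ℝ f (t, x) (0, 1)) x :=
  ((hf.differentiable (by norm_num)) (t, x)).hasFDerivAt.comp_hasDerivAt x
    ((hasDerivAt_const x t).prodMk (hasDerivAt_id x))

/-- Virial identity for a conservation law `∂ₜ P = ∂ₓ Q`, with weight `tanh (m(t) x)`. -/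
theorem hasDerivAt_virial {P Q : ℝ × ℝ → ℝ} (hP : ContDiff ℝ 1 P) (hQ : ContDiff ℝ 1 Q)
    (hPQ : ∀ z, fderiv ℝ P z (1, 0) = fderiv ℝ Q z (0, 1)) {m m' : ℝ → ℝ} {a b t R : ℝ}
    (ht : t ∈ Set.Ioo a b) (hR : 0 ≤ R) (hm : ∀ s ∈ Set.Icc a b, HasDerivAt m (m' s) s)
    (hm' : ContinuousOn m' (Set.Icc a b)) (hQR : ∀ x, R ≤ |x| → Q (t, x) = 0) :
    HasDerivAt
      (fun s => ∫ x in -R..R, Real.sinh (m s * x) / Real.cosh (m s * x) * P (s, x))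
      (∫ x in -R..R, sech (m t * x) ^ 2 * (m' t * x * P (t, x) - m t * Q (t, x))) t := by
  have hmc : ContinuousOn m (Set.Icc a b) := fun s hs => (hm s hs).continuousAt.continuousWithinAt
  have hτ : Continuous fun y => Real.sinh y / Real.cosh y :=
    Real.continuous_sinh.div Real.continuous_cosh fun x => (Real.cosh_pos x).ne'
  have hQx : Continuous fun z => fderiv ℝ Q z (0, 1) :=
    (hQ.continuous_fderiv (by norm_num)).clm_apply continuous_const
  have hmz : ContinuousOn (fun z : ℝ × ℝ => m z.1 * z.2)
      (Set.Icc a b ×ˢ Set.Icc (-R) R) :=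
    (hmc.comp continuousOn_fst fun z hz => hz.1).mul continuousOn_snd
  have hm'z : ContinuousOn (fun z : ℝ × ℝ => m' z.1 * z.2)
      (Set.Icc a b ×ˢ Set.Icc (-R) R) :=
    (hm'.comp continuousOn_fst fun z hz => hz.1).mul continuousOn_snd
  have hPc := hP.continuous
  have hQc := hQ.continuous
  have hsech := continuous_sech
  have key := hasDerivAt_intervalIntegral_of_continuousOn (t := t) (a := a) (b := b)
    (c := -R) (d := R)
    (F := fun s x => Real.sinh (m s * x) / Real.cosh (m s * x) * P (s, x))
    (F' := fun s x => sech (m s * x) ^ 2 * (m' s * x) * P (s, x)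
      + Real.sinh (m s * x) / Real.cosh (m s * x) * fderiv ℝ Q (s, x) (0, 1))
    ht (by linarith)
    (fun s _ => ((hτ.comp (continuous_const.mul continuous_id)).mul (by fun_prop)).continuousOn)
    (((((continuous_sech.pow 2).comp_continuousOn hmz).mul hm'z).mul hPc.continuousOn).add
      ((hτ.comp_continuousOn hmz).mul hQx.continuousOn))
    (fun s hs x _ => by
      have h1 := (hasDerivAt_sinh_div_cosh (m s * x)).comp s ((hm s hs).mul_const x)
      have h2 := h1.mul (hP.hasDerivAt_fst s x)
      rw [hPQ] at h2
      exact h2)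
  refine key.congr_deriv ?_
  have hτm : Continuous fun x => Real.sinh (m t * x) / Real.cosh (m t * x) :=
    hτ.comp (continuous_const.mul continuous_id)
  have hQxt : Continuous fun x => fderiv ℝ Q (t, x) (0, 1) :=
    hQx.comp (by fun_prop : Continuous fun x : ℝ => (t, x))
  have hFTC : ∫ x in -R..R, (sech (m t * x) ^ 2 * m t * Q (t, x)
      + Real.sinh (m t * x) / Real.cosh (m t * x) * fderiv ℝ Q (t, x) (0, 1)) = 0 := by
    rw [intervalIntegral.integral_eq_sub_of_hasDerivAt
      (f := fun x => Real.sinh (m t * x) / Real.cosh (m t * x) * Q (t, x))]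
    · rw [hQR R (le_abs_self R), hQR (-R) (by rw [abs_neg]; exact le_abs_self R)]
      simp
    · intro x _
      have h1 := (hasDerivAt_sinh_div_cosh (m t * x)).comp x ((hasDerivAt_id x).const_mul (m t))
      rw [mul_one] at h1
      exact h1.mul (hQ.hasDerivAt_snd t x)
    · exact Continuous.intervalIntegrable (by fun_prop) _ _
  have hsub := intervalIntegral.integral_sub (μ := volume) (a := -R) (b := R)
    (f := fun x => sech (m t * x) ^ 2 * (m' t * x) * P (t, x)
      + Real.sinh (m t * x) / Real.cosh (m t * x) * fderiv ℝ Q (t, x) (0, 1))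
    (g := fun x => sech (m t * x) ^ 2 * m t * Q (t, x)
      + Real.sinh (m t * x) / Real.cosh (m t * x) * fderiv ℝ Q (t, x) (0, 1))
    (Continuous.intervalIntegrable (by fun_prop) _ _)
    (Continuous.intervalIntegrable (by fun_prop) _ _)
  rw [hFTC, sub_zero] at hsub
  rw [← hsub]
  congr 1
  ext x
  ring

end Calculus

section Pointwise

theorem half_le_sqrt_one_add_sq_sub_sq {a b : ℝ} (h : |a| + |b| ≤ 1 / 2) :
    1 / 2 ≤ √(1 + a ^ 2 - b ^ 2) := by
  have hb : |b| ≤ 1 / 2 := by linarith [abs_nonneg a]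
  apply Real.le_sqrt_of_sq_le
  have := sq_abs b
  nlinarith [abs_nonneg b, sq_nonneg a]

theorem abs_mul_div_sqrt_le {a b : ℝ} (h : |a| + |b| ≤ 1 / 2) :
    |a * b / √(1 + a ^ 2 - b ^ 2)| ≤ a ^ 2 + b ^ 2 := by
  have hs := half_le_sqrt_one_add_sq_sub_sq h
  rw [abs_div, abs_of_pos (a := √_) (by linarith), div_le_iff₀ (by linarith), abs_mul]
  have := sq_abs a
  have := sq_abs b
  nlinarith [sq_nonneg (|a| - |b|), sq_nonneg a, sq_nonneg b]

theorem sq_add_sq_le_flux {a b : ℝ} (h : |a| + |b| ≤ 1 / 2) :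
    (a ^ 2 + b ^ 2) / 4 ≤ 1 - (1 - b ^ 2) / √(1 + a ^ 2 - b ^ 2) := by
  have hs := half_le_sqrt_one_add_sq_sub_sq h
  have hsq : √(1 + a ^ 2 - b ^ 2) ^ 2 = 1 + a ^ 2 - b ^ 2 := by
    apply Real.sq_sqrt
    by_contra! hneg
    rw [Real.sqrt_eq_zero_of_nonpos hneg.le] at hs
    norm_num at hs
  set s := √(1 + a ^ 2 - b ^ 2)
  have ha : a ^ 2 ≤ 1 / 4 := by
    rw [← sq_abs]; nlinarith [abs_nonneg a, abs_nonneg b]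
  have hb : b ^ 2 ≤ 1 / 4 := by
    rw [← sq_abs]; nlinarith [abs_nonneg a, abs_nonneg b]
  have ha0 := sq_nonneg a
  have hb0 := sq_nonneg b
  have key : 1 - b ^ 2 ≤ s * (1 - (a ^ 2 + b ^ 2) / 4) := by
    apply le_of_sq_le_sq _ (mul_nonneg (by linarith) (by linarith))
    rw [mul_pow, hsq]
    generalize a ^ 2 = A at *
    generalize b ^ 2 = B at *
    have h1 : (1 + A - B) * (1 - (A + B) / 2) ≤ (1 + A - B) * (1 - (A + B) / 4) ^ 2 := by
      apply mul_le_mul_of_nonneg_left _ (by linarith)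
      nlinarith [sq_nonneg (A + B)]
    nlinarith
  have : (1 - b ^ 2) / s ≤ 1 - (a ^ 2 + b ^ 2) / 4 := by
    rw [div_le_iff₀ (by linarith)]
    linarith
  linarith

end Pointwise

section BornInfeld

variable {u : ℝ × ℝ → ℝ}

theorem ut_eq_fderiv (hu : ContDiff ℝ 2 u) (t x : ℝ) :
    ut u t x = fderiv ℝ u (t, x) (1, 0) :=
  ((hu.of_le (by norm_num)).hasDerivAt_fst t x).deriv

theorem ux_eq_fderiv (hu : ContDiff ℝ 2 u) (t x : ℝ) :
    ux u t x = fderiv ℝ u (t, x) (0, 1) :=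
  ((hu.of_le (by norm_num)).hasDerivAt_snd t x).deriv

theorem contDiff_ut (hu : ContDiff ℝ 2 u) : ContDiff ℝ 1 fun z : ℝ × ℝ => ut u z.1 z.2 := by
  simp only [ut_eq_fderiv hu]
  exact (hu.fderiv_right (m := 1) (by norm_num)).clm_apply contDiff_const

theorem contDiff_ux (hu : ContDiff ℝ 2 u) : ContDiff ℝ 1 fun z : ℝ × ℝ => ux u z.1 z.2 := by
  simp only [ux_eq_fderiv hu]
  exact (hu.fderiv_right (m := 1) (by norm_num)).clm_apply contDiff_const

theorem hasDerivAt_ut_fst (hu : ContDiff ℝ 2 u) (t x : ℝ) :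
    HasDerivAt (fun s => ut u s x) (utt u t x) t :=
  ((contDiff_ut hu).hasDerivAt_fst t x).differentiableAt.hasDerivAt

theorem hasDerivAt_ux_fst (hu : ContDiff ℝ 2 u) (t x : ℝ) :
    HasDerivAt (fun s => ux u s x) (utx u t x) t :=
  ((contDiff_ux hu).hasDerivAt_fst t x).differentiableAt.hasDerivAt

theorem hasDerivAt_ux_snd (hu : ContDiff ℝ 2 u) (t x : ℝ) :
    HasDerivAt (fun y => ux u t y) (uxx u t x) x :=
  ((contDiff_ux hu).hasDerivAt_snd t x).differentiableAt.hasDerivAt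

theorem hasDerivAt_ut_snd (hu : ContDiff ℝ 2 u) (t x : ℝ) :
    HasDerivAt (fun y => ut u t y) (utx u t x) x := by
  have hD : DifferentiableAt ℝ (fderiv ℝ u) (t, x) :=
    (hu.fderiv_right (m := 1) (by norm_num)).differentiable (by norm_num) _
  have hsymm : IsSymmSndFDerivAt ℝ u (t, x) :=
    hu.contDiffAt.isSymmSndFDerivAt (by simp)
  have h1 : HasDerivAt (fun s => ux u s x) (fderiv ℝ (fderiv ℝ u) (t, x) (1, 0) (0, 1)) t := by
    simp only [ux_eq_fderiv hu]
    exact (ContinuousLinearMap.apply ℝ ℝ ((0, 1) : ℝ × ℝ)).hasFDerivAt.comp_hasDerivAt t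
      (hD.hasFDerivAt.comp_hasDerivAt t ((hasDerivAt_id t).prodMk (hasDerivAt_const t x)))
  have h2 : HasDerivAt (fun y => ut u t y) (fderiv ℝ (fderiv ℝ u) (t, x) (0, 1) (1, 0)) x := by
    simp only [ut_eq_fderiv hu]
    exact (ContinuousLinearMap.apply ℝ ℝ ((1, 0) : ℝ × ℝ)).hasFDerivAt.comp_hasDerivAt x
      (hD.hasFDerivAt.comp_hasDerivAt x ((hasDerivAt_const x t).prodMk (hasDerivAt_id x)))
  rwa [hsymm.eq, h1.unique (hasDerivAt_ux_fst hu t x)] at h2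

/-- The square root `√(1 + (∂ₓu)² - (∂ₜu)²)` of the Born–Infeld Lagrangian. -/
noncomputable def biRoot (u : ℝ × ℝ → ℝ) (z : ℝ × ℝ) : ℝ :=
  √(1 + ux u z.1 z.2 ^ 2 - ut u z.1 z.2 ^ 2)

/-- The momentum density of a Born–Infeld field. -/
noncomputable def biMomentum (u : ℝ × ℝ → ℝ) (z : ℝ × ℝ) : ℝ :=
  ux u z.1 z.2 * ut u z.1 z.2 / biRoot u z

/-- The momentum flux of a Born–Infeld field. -/
noncomputable def biFlux (u : ℝ × ℝ → ℝ) (z : ℝ × ℝ) : ℝ :=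
  1 - (1 - ut u z.1 z.2 ^ 2) / biRoot u z

theorem abs_biMomentum_le (hs : ∀ t x : ℝ, |ux u t x| + |ut u t x| ≤ 1 / 2) (t x : ℝ) :
    |biMomentum u (t, x)| ≤ ux u t x ^ 2 + ut u t x ^ 2 :=
  abs_mul_div_sqrt_le (hs t x)

theorem le_biFlux (hs : ∀ t x : ℝ, |ux u t x| + |ut u t x| ≤ 1 / 2) (t x : ℝ) :
    (ux u t x ^ 2 + ut u t x ^ 2) / 4 ≤ biFlux u (t, x) :=
  sq_add_sq_le_flux (hs t x)

theorem biRoot_pos (hs : ∀ t x : ℝ, |ux u t x| + |ut u t x| ≤ 1 / 2) (z : ℝ × ℝ) :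
    0 < biRoot u z :=
  lt_of_lt_of_le (by norm_num) (half_le_sqrt_one_add_sq_sub_sq (hs z.1 z.2))

theorem contDiff_biRoot (hu : ContDiff ℝ 2 u)
    (hs : ∀ t x : ℝ, |ux u t x| + |ut u t x| ≤ 1 / 2) : ContDiff ℝ 1 (biRoot u) :=
  ((contDiff_const.add ((contDiff_ux hu).pow 2)).sub ((contDiff_ut hu).pow 2)).sqrt
    fun z => (Real.sqrt_pos.1 (biRoot_pos hs z)).ne'

theorem contDiff_biMomentum (hu : ContDiff ℝ 2 u)
    (hs : ∀ t x : ℝ, |ux u t x| + |ut u t x| ≤ 1 / 2) : ContDiff ℝ 1 (biMomentum u) :=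
  ((contDiff_ux hu).mul (contDiff_ut hu)).div (contDiff_biRoot hu hs)
    fun z => (biRoot_pos hs z).ne'

theorem contDiff_biFlux (hu : ContDiff ℝ 2 u)
    (hs : ∀ t x : ℝ, |ux u t x| + |ut u t x| ≤ 1 / 2) : ContDiff ℝ 1 (biFlux u) :=
  contDiff_const.sub ((contDiff_const.sub ((contDiff_ut hu).pow 2)).div (contDiff_biRoot hu hs)
    fun z => (biRoot_pos hs z).ne')

/-- Conservation of momentum: `∂ₜ (momentum) = ∂ₓ (flux)`. -/
theorem fderiv_biMomentum_eq (hu : ContDiff ℝ 2 u) (hsol : IsBISol u)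
    (hs : ∀ t x : ℝ, |ux u t x| + |ut u t x| ≤ 1 / 2) (z : ℝ × ℝ) :
    fderiv ℝ (biMomentum u) z (1, 0) = fderiv ℝ (biFlux u) z (0, 1) := by
  obtain ⟨t, x⟩ := z
  have hpos : 0 < biRoot u (t, x) := biRoot_pos hs (t, x)
  have hne : 1 + ux u t x ^ 2 - ut u t x ^ 2 ≠ 0 := (Real.sqrt_pos.1 hpos).ne'
  have hsq : biRoot u (t, x) ^ 2 = 1 + ux u t x ^ 2 - ut u t x ^ 2 :=
    Real.sq_sqrt (Real.sqrt_pos.1 hpos).le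
  have hRt : HasDerivAt (fun s => biRoot u (s, x))
      ((ux u t x * utx u t x - ut u t x * utt u t x) / biRoot u (t, x)) t := by
    refine (((((hasDerivAt_ux_fst hu t x).pow 2).const_add 1).sub
      ((hasDerivAt_ut_fst hu t x).pow 2)).sqrt hne).congr_deriv ?_
    change _ / (2 * biRoot u (t, x)) = _
    field_simp
    ring
  have hRx : HasDerivAt (fun y => biRoot u (t, y))
      ((ux u t x * uxx u t x - ut u t x * utx u t x) / biRoot u (t, x)) x := by
    refine (((((hasDerivAt_ux_snd hu t x).pow 2).const_add 1).sub
      ((hasDerivAt_ut_snd hu t x).pow 2)).sqrt hne).congr_deriv ?_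
    change _ / (2 * biRoot u (t, x)) = _
    field_simp
    ring
  have hP : HasDerivAt (fun s => biMomentum u (s, x)) _ t :=
    ((hasDerivAt_ux_fst hu t x).mul (hasDerivAt_ut_fst hu t x)).div hRt hpos.ne'
  have hQ : HasDerivAt (fun y => biFlux u (t, y)) _ x :=
    ((((hasDerivAt_ut_snd hu t x).pow 2).const_sub 1).div hRx hpos.ne').const_sub 1
  rw [((contDiff_biMomentum hu hs).hasDerivAt_fst t x).unique hP,
    ((contDiff_biFlux hu hs).hasDerivAt_snd t x).unique hQ]
  have heq := hsol t x
  simp only [Pi.mul_apply, Pi.pow_apply]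
  set r := biRoot u (t, x)
  field_simp
  rw [hsq]
  push_cast
  linear_combination (-ux u t x) * heq

/-- Pointwise form of the virial estimate. -/
theorem virial_integrand_le (hs : ∀ t x : ℝ, |ux u t x| + |ut u t x| ≤ 1 / 2) {m m' : ℝ}
    (hm : 0 < m) (t x : ℝ) :
    sech (m * x) ^ 2 * (m' * x * biMomentum u (t, x) - m * biFlux u (t, x)) ≤
      |m'| / m * (ux u t x ^ 2 + ut u t x ^ 2)
        - m / 4 * (sech (m * x) ^ 2 * (ut u t x ^ 2 + ux u t x ^ 2)) := by
  have h1 := sech_sq_mul_abs_le_one (m * x)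
  have h2 := abs_biMomentum_le hs t x
  have h3 := mul_le_mul_of_nonneg_left (le_biFlux hs t x)
    (mul_nonneg (sq_nonneg (sech (m * x))) hm.le)
  set e := ux u t x ^ 2 + ut u t x ^ 2 with he
  have he0 : 0 ≤ e := by positivity
  have h4 : sech (m * x) ^ 2 * (m' * x * biMomentum u (t, x)) ≤ |m'| / m * e := by
    calc sech (m * x) ^ 2 * (m' * x * biMomentum u (t, x))
        ≤ |sech (m * x) ^ 2 * (m' * x * biMomentum u (t, x))| := le_abs_self _
      _ = |m'| / m * ((sech (m * x) ^ 2 * |m * x|) * |biMomentum u (t, x)|) := by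
        rw [abs_mul, abs_mul, abs_mul, abs_mul, abs_of_nonneg (sq_nonneg _), abs_of_pos hm]
        field_simp
      _ ≤ |m'| / m * (1 * e) := by gcongr
      _ = |m'| / m * e := by ring
  rw [add_comm (ut u t x ^ 2), ← he]
  linarith

/-- Energy localised at scale `λ(t)` cannot stay bounded below. -/
theorem exists_localized_energy_lt {C ε : ℝ} (hC : 0 < C) (hu : ContDiff ℝ 2 u)
    (hsol : IsBISol u) (hs : ∀ t x : ℝ, |ux u t x| + |ut u t x| ≤ 1 / 2)
    (hE : ∀ t : ℝ, ∫ x : ℝ, ((ux u t x) ^ 2 + (ut u t x) ^ 2) ≤ ε ^ 2)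
    (hsupp : ∀ T : ℝ, ∃ R : ℝ, ∀ t x : ℝ, |t| ≤ T → R ≤ |x| → ux u t x = 0 ∧ ut u t x = 0)
    {c : ℝ} (hc : 0 < c) (T : ℝ) :
    ∃ t, T ≤ t ∧ ∫ x : ℝ, sech (x / lam C t) ^ 2 * (ut u t x ^ 2 + ux u t x ^ 2) < c := by
  by_contra! hlow
  set m : ℝ → ℝ := fun t => Real.log t ^ 2 / (C * t) with hm_def
  set m' : ℝ → ℝ := fun t => (2 * Real.log t - Real.log t ^ 2) / (C * t ^ 2) with hm'_def
  have hlam : ∀ t x, x / lam C t = m t * x := fun t x => by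
    rw [lam, div_div_eq_mul_div, hm_def]; ring
  simp only [hlam] at hlow
  have hP := contDiff_biMomentum hu hs
  have hQ := contDiff_biFlux hu hs
  have hPt : ∀ t, Continuous fun x => biMomentum u (t, x) := fun t =>
    hP.continuous.comp (by fun_prop : Continuous fun x : ℝ => (t, x))
  have hQt : ∀ t, Continuous fun x => biFlux u (t, x) := fun t =>
    hQ.continuous.comp (by fun_prop : Continuous fun x : ℝ => (t, x))
  have hux : ∀ t, Continuous fun x => ux u t x := fun t =>
    (contDiff_ux hu).continuous.comp (by fun_prop : Continuous fun x : ℝ => (t, x))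
  have hut : ∀ t, Continuous fun x => ut u t x := fun t =>
    (contDiff_ut hu).continuous.comp (by fun_prop : Continuous fun x : ℝ => (t, x))
  have hP0 : ∀ t x, ux u t x = 0 ∧ ut u t x = 0 → biMomentum u (t, x) = 0 := fun t x h => by
    simp [biMomentum, h.1]
  have hQ0 : ∀ t x, ux u t x = 0 ∧ ut u t x = 0 → biFlux u (t, x) = 0 := fun t x h => by
    simp [biFlux, biRoot, h.1, h.2]
  have hsech := continuous_sech
  have hEint : ∀ t, Integrable fun x => ux u t x ^ 2 + ut u t x ^ 2 := fun t => by
    obtain ⟨R, hR⟩ := hsupp |t|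
    have := hux t
    have := hut t
    exact integrable_of_continuous_of_vanishing (R := R) (by fun_prop) fun x hx => by
      simp [hR t x le_rfl hx]
  have hFint : ∀ t, Integrable fun x => sech (m t * x) ^ 2 * (ut u t x ^ 2 + ux u t x ^ 2) :=
    fun t => by
      obtain ⟨R, hR⟩ := hsupp |t|
      have := hux t
      have := hut t
      exact integrable_of_continuous_of_vanishing (R := R) (by fun_prop) fun x hx => by
        simp [hR t x le_rfl hx]
  have hDint : ∀ t, Integrable fun x =>
      sech (m t * x) ^ 2 * (m' t * x * biMomentum u (t, x) - m t * biFlux u (t, x)) :=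
    fun t => by
      obtain ⟨R, hR⟩ := hsupp |t|
      have := hPt t
      have := hQt t
      exact integrable_of_continuous_of_vanishing (R := R) (by fun_prop) fun x hx => by
        simp [hP0 t x (hR t x le_rfl hx), hQ0 t x (hR t x le_rfl hx)]
  have hm : ∀ t, 1 < t → HasDerivAt m (m' t) t := fun t ht => by
    have ht0 : t ≠ 0 := by linarith
    refine (((Real.hasDerivAt_log ht0).pow 2).div ((hasDerivAt_id t).const_mul C)
      (mul_ne_zero hC.ne' ht0)).congr_deriv ?_
    simp only [hm'_def, Pi.pow_apply, id]
    field_simp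
    ring
  have hm'c : ContinuousOn m' (Set.Ioi 1) := by
    have hlog : ContinuousOn Real.log (Set.Ioi 1) := Real.continuousOn_log.mono fun t ht => by
      simp only [Set.mem_Ioi] at ht
      simp only [Set.mem_compl_iff, Set.mem_singleton_iff]
      linarith
    refine ContinuousOn.div (by fun_prop) (by fun_prop) fun t ht => ?_
    simp only [Set.mem_Ioi] at ht
    have : 0 < t := by linarith
    positivity
  set V : ℝ → ℝ := fun t =>
    ∫ x, Real.sinh (m t * x) / Real.cosh (m t * x) * biMomentum u (t, x)
  have hVbound : ∀ t, -ε ^ 2 ≤ V t := fun t => by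
    have h : ‖V t‖ ≤ ∫ x, (ux u t x ^ 2 + ut u t x ^ 2) := by
      refine norm_integral_le_of_norm_le (hEint t) (.of_forall fun x => ?_)
      rw [norm_mul, Real.norm_eq_abs, Real.norm_eq_abs]
      calc _ ≤ 1 * (ux u t x ^ 2 + ut u t x ^ 2) :=
            mul_le_mul (abs_sinh_div_cosh_le_one _) (abs_biMomentum_le hs t x) (abs_nonneg _)
              zero_le_one
        _ = _ := one_mul _
    exact (abs_le.1 (h.trans (hE t))).1
  set V' : ℝ → ℝ := fun t => ∫ x,
    sech (m t * x) ^ 2 * (m' t * x * biMomentum u (t, x) - m t * biFlux u (t, x))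
  have hV : ∀ t, 1 < t → HasDerivAt V (V' t) t := fun t ht => by
    obtain ⟨R₀, hR₀⟩ := hsupp (t + 1)
    have hR : ∀ s x, |s| ≤ t + 1 → max R₀ 0 ≤ |x| → ux u s x = 0 ∧ ut u s x = 0 :=
      fun s x h hx => hR₀ s x h ((le_max_left _ _).trans hx)
    obtain ⟨a, ha1, hat⟩ := exists_between ht
    have hIcc : Set.Icc a (t + 1) ⊆ Set.Ioi 1 := fun s hs => lt_of_lt_of_le ha1 hs.1
    have habs : ∀ s ∈ Set.Icc a (t + 1), |s| ≤ t + 1 := fun s hs =>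
      abs_le.2 ⟨by linarith [hs.1], hs.2⟩
    have htm : t ∈ Set.Ioo a (t + 1) := ⟨hat, by linarith⟩
    have key := hasDerivAt_virial hP hQ (fderiv_biMomentum_eq hu hsol hs) htm
      (le_max_right R₀ 0) (fun s hs => hm s (hIcc hs)) (hm'c.mono hIcc)
      (fun x hx => hQ0 t x (hR t x (habs t (Set.Ioo_subset_Icc_self htm)) hx))
    rw [← integral_eq_intervalIntegral_of_vanishing fun x hx => by
      have := hR t x (habs t (Set.Ioo_subset_Icc_self htm)) hx
      simp [hP0 t x this, hQ0 t x this]] at key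
    refine key.congr_of_eventuallyEq ?_
    filter_upwards [Icc_mem_nhds htm.1 htm.2] with s hs'
    exact integral_eq_intervalIntegral_of_vanishing fun x hx => by
      simp [hP0 s x (hR s x (habs s hs') hx)]
  have hV'le : ∀ t, 1 < t → V' t ≤ |m' t| / m t * ε ^ 2
      - m t / 4 * ∫ x, sech (m t * x) ^ 2 * (ut u t x ^ 2 + ux u t x ^ 2) := fun t ht => by
    have hmt : 0 < m t := by
      have := Real.log_pos ht
      have : 0 < t := by linarith
      simp only [hm_def]; positivity
    have h := integral_mono (hDint t) (((hEint t).const_mul _).sub ((hFint t).const_mul _))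
      fun x => virial_integrand_le (m' := m' t) hs hmt t x
    simp only [Pi.sub_apply] at h
    rw [integral_sub ((hEint t).const_mul _) ((hFint t).const_mul _), integral_const_mul,
      integral_const_mul] at h
    refine h.trans ?_
    gcongr
    exact hE t
  obtain ⟨T₁, hT₁⟩ := eventually_atTop.1 (((eventually_ge_atTop T).and
    (eventually_gt_atTop 1)).and ((Real.tendsto_log_atTop.eventually_ge_atTop 1).and
    (Real.tendsto_log_atTop.eventually_ge_atTop (24 * C * ε ^ 2 / c))))
  have hT₁1 : 1 < T₁ := (hT₁ T₁ le_rfl).1.2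
  refine not_bddBelow_of_hasDerivAt_le_neg_div (T := T₁) (k := c / (8 * C)) (V := V) (V' := V')
    (by linarith) (by positivity) (fun t ht => hV t (by linarith)) (fun t ht => ?_)
    (fun t _ => hVbound t)
  obtain ⟨⟨htT, ht1⟩, hL1, hL2⟩ := hT₁ t ht
  refine (hV'le t ht1).trans ?_
  have hF := hlow t htT
  have ht0 : 0 < t := by linarith
  set L := Real.log t
  have hmt : m t = L ^ 2 / (C * t) := rfl
  have hmpos : 0 < m t := by rw [hmt]; positivity
  have h1 : |m' t| / m t * ε ^ 2 ≤ c / 8 * m t := by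
    have habs : |m' t| ≤ 3 * L ^ 2 / (C * t ^ 2) := by
      simp only [hm'_def]
      rw [abs_div, abs_of_pos (a := C * t ^ 2) (by positivity)]
      gcongr
      rw [abs_le]
      constructor <;> nlinarith
    rw [div_mul_eq_mul_div, div_le_iff₀ hmpos]
    rw [div_le_iff₀ hc] at hL2
    calc |m' t| * ε ^ 2 ≤ 3 * L ^ 2 / (C * t ^ 2) * ε ^ 2 := by gcongr
      _ = (24 * C * ε ^ 2) * (L ^ 2 / (8 * C ^ 2 * t ^ 2)) := by field_simp; ring
      _ ≤ (L * c) * (L ^ 2 / (8 * C ^ 2 * t ^ 2)) := by gcongr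
      _ ≤ (L ^ 2 * c) * (L ^ 2 / (8 * C ^ 2 * t ^ 2)) := by gcongr; nlinarith
      _ = c / 8 * m t * m t := by rw [hmt]; field_simp
  have h2 : m t / 4 * c ≤ m t / 4 *
      ∫ x, sech (m t * x) ^ 2 * (ut u t x ^ 2 + ux u t x ^ 2) := by gcongr
  have h3 : c / (8 * C) / t ≤ c / 8 * m t := by
    rw [hmt, div_div, div_mul_div_comm, ← mul_assoc]
    gcongr
    exact le_mul_of_one_le_right hc.le (one_le_pow₀ hL1)
  linarith

end BornInfeld


/-- Sequential decay (Lemma 2.3, (seq)): there exists a strictly increasing sequence of times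
`tₙ → +∞` along which `∫ sech²(x/λ(tₙ)) ((∂ₜu)² + (∂ₓu)²)(tₙ,x) dx → 0`. -/
theorem sequential_decay :
    ∃ ε₀ : ℝ, 0 < ε₀ ∧ ∀ C : ℝ, 0 < C → ∀ ε : ℝ, 0 < ε → ε ≤ ε₀ →
    ∀ u : ℝ × ℝ → ℝ, ContDiff ℝ 2 u → IsBISol u →
    (∀ t x : ℝ, |ux u t x| + |ut u t x| ≤ ε) →
    (∀ t : ℝ, ∫ x : ℝ, ((ux u t x) ^ 2 + (ut u t x) ^ 2) ≤ ε ^ 2) →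
    (∀ T : ℝ, ∃ R : ℝ, ∀ t x : ℝ, |t| ≤ T → R ≤ |x| → ux u t x = 0 ∧ ut u t x = 0) →
    ∃ tseq : ℕ → ℝ, StrictMono tseq ∧ Tendsto tseq atTop atTop ∧
      Tendsto (fun n => ∫ x : ℝ, (sech (x / lam C (tseq n))) ^ 2
          * ((ut u (tseq n) x) ^ 2 + (ux u (tseq n) x) ^ 2)) atTop (nhds 0) := by
  refine ⟨1 / 2, by norm_num, fun C hC ε _ hε u hu hsol hs hE hsupp => ?_⟩
  exact exists_strictMono_tendsto_zero
    (fun t => integral_nonneg fun x => by positivity)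
    fun c hc T => exists_localized_energy_lt hC hu hsol (fun t x => (hs t x).trans hε) hE hsupp hc T
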